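/- Let x: U → ℝ³ be a smooth immersed surface with unit normal N whose image x(U) is contained in a round sphere {y ∈ ℝ³ : |y − c| = ρ} (c ∈ ℝ³, ρ > 0). Then the normal bundle immersion f(p,t) = (x(p), t·N(p)) is a Maslovian Lagrangian immersion into ℂ³. -/

import Mathlib

noncomputable section

open scoped InnerProductSpace

/-- Euclidean 3-space. -/
abbrev E3 : Type := EuclideanSpace ℝ (Fin 3)

/-- ℝ⁶ = ℝ³ × ℝ³, identified with ℂ³. -/
abbrev V6 : Type := E3 × E3

/-- The domain of the normal bundle immersion: ℝ² × ℝ. -/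
abbrev W3 : Type := (ℝ × ℝ) × ℝ

/-- The standard inner product on ℝ⁶ = ℝ³ × ℝ³. -/
def ip6 (v w : V6) : ℝ := ⟪v.1, w.1⟫_ℝ + ⟪v.2, w.2⟫_ℝ

/-- The complex structure J(X, Y) = (−Y, X) on ℝ³ × ℝ³ = ℂ³. -/
def Jc (v : V6) : V6 := (-v.2, v.1)

/-- The normal bundle immersion f(p, t) = (x(p), t·N(p)). -/
def nbi (x N : ℝ × ℝ → E3) : W3 → V6 := fun q => (x q.1, q.2 • N q.1)

/-- Second derivative of `g` at `q` in directions `v`, `w`. -/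
def d2 (g : W3 → V6) (q v w : W3) : V6 := fderiv ℝ (fun y => fderiv ℝ g y w) q v

/-- `n` is orthogonal to the tangent space (range of the differential) of `g` at `q`. -/
def IsNormalAt (g : W3 → V6) (q : W3) (n : V6) : Prop :=
  ∀ v : W3, ip6 n (fderiv ℝ g q v) = 0

/-- `n` is the second fundamental form `h(v, w)` of `g` at `q`: the orthogonal projection of
the second derivative in directions `v`, `w` onto the orthogonal complement of the tangent
space. -/
def IsSFF (g : W3 → V6) (q v w : W3) (n : V6) : Prop :=
  IsNormalAt g q n ∧ d2 g q v w - n ∈ Set.range ⇑(fderiv ℝ g q)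

/-- `v₁, v₂, v₃` is an orthonormal frame at `q` for the metric induced by `g`. -/
def ONFrame (g : W3 → V6) (q : W3) (v₁ v₂ v₃ : W3) : Prop :=
  ip6 (fderiv ℝ g q v₁) (fderiv ℝ g q v₁) = 1 ∧
  ip6 (fderiv ℝ g q v₂) (fderiv ℝ g q v₂) = 1 ∧
  ip6 (fderiv ℝ g q v₃) (fderiv ℝ g q v₃) = 1 ∧
  ip6 (fderiv ℝ g q v₁) (fderiv ℝ g q v₂) = 0 ∧
  ip6 (fderiv ℝ g q v₁) (fderiv ℝ g q v₃) = 0 ∧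
  ip6 (fderiv ℝ g q v₂) (fderiv ℝ g q v₃) = 0

/-- `Hq` is the mean curvature vector of `g` at `q`:
`H = Σᵢ h(ẽᵢ, ẽᵢ)` for an orthonormal frame `ẽ₁, ẽ₂, ẽ₃` of the induced metric. -/
def IsMeanCurvAt (g : W3 → V6) (q : W3) (Hq : V6) : Prop :=
  ∃ v₁ v₂ v₃ : W3, ONFrame g q v₁ v₂ v₃ ∧
    ∃ n₁ n₂ n₃ : V6, IsSFF g q v₁ v₁ n₁ ∧ IsSFF g q v₂ v₂ n₂ ∧ IsSFF g q v₃ v₃ n₃ ∧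
      Hq = n₁ + n₂ + n₃

/-- `u = A_ξ v`, the shape operator of `g` at `q` with respect to the normal vector `ξ`,
characterized by `⟨dg(A_ξ v), dg(w)⟩ = ⟨h(v, w), ξ⟩` for all `w`. -/
def IsShapeAt (g : W3 → V6) (q : W3) (ξ : V6) (v u : W3) : Prop :=
  ∀ w : W3, ∀ n : V6, IsSFF g q v w n →
    ip6 (fderiv ℝ g q u) (fderiv ℝ g q w) = ip6 n ξ

/-- `g` is a Lagrangian immersion at `q`: the differential is injective and `J` maps the
tangent space onto its orthogonal complement. -/
def LagrangianAt (g : W3 → V6) (q : W3) : Prop :=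
  Function.Injective ⇑(fderiv ℝ g q) ∧
    Jc '' Set.range ⇑(fderiv ℝ g q) =
      {u : V6 | ∀ w ∈ Set.range ⇑(fderiv ℝ g q), ip6 u w = 0}

/-- The Maslovian condition at `q` for the mean curvature vector `Hq`: `Hq ≠ 0` and
`A_H(JH)` is a real scalar multiple of `JH` (expressed via the tangent vector `V`
with `dg(V) = J Hq`). -/
def MaslovianAt (g : W3 → V6) (q : W3) (Hq : V6) : Prop :=
  Hq ≠ 0 ∧ ∀ V u : W3, fderiv ℝ g q V = Jc Hq → IsShapeAt g q Hq V u → ∃ c : ℝ, u = c • V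

/-- Standard hypotheses: `U` is a connected open set, `x` is a smooth immersion on `U`, and
`N` is a smooth unit normal field along `x` on `U`. -/
structure SurfaceData (U : Set (ℝ × ℝ)) (x N : ℝ × ℝ → E3) : Prop where
  open_U : IsOpen U
  conn_U : IsConnected U
  smooth_x : ContDiffOn ℝ (⊤ : ℕ∞) x U
  smooth_N : ContDiffOn ℝ (⊤ : ℕ∞) N U
  immersion : ∀ p ∈ U, Function.Injective ⇑(fderiv ℝ x p)
  unit_N : ∀ p ∈ U, ‖N p‖ = 1
  normal_N : ∀ p ∈ U, ∀ v : ℝ × ℝ, ⟪N p, fderiv ℝ x p v⟫_ℝ = 0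

/-- `x` is minimal at `p`: the trace of the shape operator `A = −dN ∘ dx⁻¹` vanishes,
expressed via orthonormal frames of the induced metric. -/
def SurfMinimalAt (x N : ℝ × ℝ → E3) (p : ℝ × ℝ) : Prop :=
  ∀ v₁ v₂ : ℝ × ℝ,
    ⟪fderiv ℝ x p v₁, fderiv ℝ x p v₁⟫_ℝ = 1 →
    ⟪fderiv ℝ x p v₂, fderiv ℝ x p v₂⟫_ℝ = 1 →
    ⟪fderiv ℝ x p v₁, fderiv ℝ x p v₂⟫_ℝ = 0 →
    ⟪fderiv ℝ N p v₁, fderiv ℝ x p v₁⟫_ℝ + ⟪fderiv ℝ N p v₂, fderiv ℝ x p v₂⟫_ℝ = 0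

/-- A rigid motion of ℝ³: `y ↦ S y + c` with `S ∈ SO(3)`. -/
def RigidMotion (Φ : E3 → E3) : Prop :=
  ∃ (S : E3 ≃ₗᵢ[ℝ] E3) (c : E3),
    LinearMap.det (S.toLinearEquiv : E3 →ₗ[ℝ] E3) = 1 ∧ ∀ y, Φ y = S y + c

/-- The circular cone `C_r = {(s·r·cos θ, s·r·sin θ, s)/√(r²+1) : s > 0, θ ∈ ℝ}`. -/
def coneSet (r : ℝ) : Set E3 :=
  { y | ∃ s θ : ℝ, 0 < s ∧
      y 0 = s * r * Real.cos θ / Real.sqrt (r ^ 2 + 1) ∧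
      y 1 = s * r * Real.sin θ / Real.sqrt (r ^ 2 + 1) ∧
      y 2 = s / Real.sqrt (r ^ 2 + 1) }

/-- `x(U)` is contained in a round sphere. -/
def InRoundSphere (U : Set (ℝ × ℝ)) (x : ℝ × ℝ → E3) : Prop :=
  ∃ (c : E3) (ρ : ℝ), 0 < ρ ∧ ∀ p ∈ U, ‖x p - c‖ = ρ

/-- `x(U)` is contained in a circular cylinder. -/
def InCircularCylinder (U : Set (ℝ × ℝ)) (x : ℝ × ℝ → E3) : Prop :=
  ∃ (c w : E3) (ρ : ℝ), ‖w‖ = 1 ∧ 0 < ρ ∧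
    ∀ p ∈ U, ‖(x p - c) - ⟪x p - c, w⟫_ℝ • w‖ = ρ

/-- `x(U)` is contained in a circular cone: the image under a rigid motion of `C_r`, `r ≠ 0`. -/
def InCircularCone (U : Set (ℝ × ℝ)) (x : ℝ × ℝ → E3) : Prop :=
  ∃ r : ℝ, r ≠ 0 ∧ ∃ Φ : E3 → E3, RigidMotion Φ ∧ ∀ p ∈ U, x p ∈ Φ '' coneSet r

section AbstractFrame

variable {L : ℝ × ℝ →L[ℝ] E3} {n : E3} {a : ℝ}

/-- A unit vector normal to an injective image of the plane in `E3` has that image as its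
orthogonal complement. -/
lemma exists_preimage_of_inner_normal_eq_zero (hL : Function.Injective L)
    (hn : ‖n‖ = 1) (hnL : ∀ v, ⟪n, L v⟫_ℝ = 0) (y : E3) (hy : ⟪n, y⟫_ℝ = 0) :
    ∃ v, L v = y := by
  have hn0 : n ≠ 0 := by
    rintro rfl
    simp at hn
  have hle : LinearMap.range (L : ℝ × ℝ →ₗ[ℝ] E3) ≤ (ℝ ∙ n)ᗮ := by
    rintro _ ⟨v, rfl⟩
    exact Submodule.mem_orthogonal_singleton_iff_inner_right.2 (hnL v)
  have h1 : Module.finrank ℝ (LinearMap.range (L : ℝ × ℝ →ₗ[ℝ] E3)) = 2 := by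
    rw [LinearMap.finrank_range_of_inj hL]
    simp
  have h2 : Module.finrank ℝ ((ℝ ∙ n)ᗮ : Submodule ℝ E3) = 2 := by
    have : Fact (Module.finrank ℝ E3 = 2 + 1) := ⟨by simp⟩
    exact Submodule.finrank_orthogonal_span_singleton hn0
  have heq := Submodule.eq_of_le_of_finrank_eq hle (h1.trans h2.symm)
  have hmem : y ∈ LinearMap.range (L : ℝ × ℝ →ₗ[ℝ] E3) := by
    rw [heq]
    exact Submodule.mem_orthogonal_singleton_iff_inner_right.2 hy
  exact hmem

/-- Decomposition into a tangential and a normal part. -/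
lemma exists_eq_add_smul_normal (hL : Function.Injective L)
    (hn : ‖n‖ = 1) (hnL : ∀ v, ⟪n, L v⟫_ℝ = 0) (y : E3) :
    ∃ v, y = L v + ⟪n, y⟫_ℝ • n := by
  obtain ⟨v, hv⟩ := exists_preimage_of_inner_normal_eq_zero hL hn hnL (y - ⟪n, y⟫_ℝ • n) (by
    rw [inner_sub_right, real_inner_smul_right, real_inner_self_eq_norm_sq, hn]
    ring)
  exact ⟨v, by rw [hv]; abel⟩

/-- The differential `(v, s) ↦ (L v, a L v + s n)` of the normal bundle immersion of a piece
of a sphere. -/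
def bundleDiff (L : ℝ × ℝ →L[ℝ] E3) (n : E3) (a : ℝ) (v : W3) : V6 :=
  (L v.1, a • L v.1 + v.2 • n)

lemma bundleDiff_injective (hL : Function.Injective L) (hn : ‖n‖ = 1) :
    Function.Injective (bundleDiff L n a) := by
  have hn0 : n ≠ 0 := by
    rintro rfl
    simp at hn
  intro v w h
  have h1 : L v.1 = L w.1 := congrArg Prod.fst h
  have h2 : a • L v.1 + v.2 • n = a • L w.1 + w.2 • n := congrArg Prod.snd h
  rw [h1] at h2
  exact Prod.ext (hL h1) (smul_left_injective ℝ hn0 (add_left_cancel h2))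

lemma ip6_bundleDiff (hn : ‖n‖ = 1) (hnL : ∀ v, ⟪n, L v⟫_ℝ = 0) (v w : W3) :
    ip6 (bundleDiff L n a v) (bundleDiff L n a w) =
      (1 + a ^ 2) * ⟪L v.1, L w.1⟫_ℝ + v.2 * w.2 := by
  simp only [ip6, bundleDiff, inner_add_left, inner_add_right, real_inner_smul_left,
    real_inner_smul_right, real_inner_self_eq_norm_sq, hn, hnL, real_inner_comm n]
  ring

lemma ip6_Jc_bundleDiff (hnL : ∀ v, ⟪n, L v⟫_ℝ = 0) (v w : W3) :
    ip6 (Jc (bundleDiff L n a v)) (bundleDiff L n a w) = 0 := by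
  have h := fun v => (real_inner_comm n (L v)).trans (hnL v)
  simp only [ip6, bundleDiff, Jc, inner_add_left, inner_add_right, real_inner_smul_left,
    real_inner_smul_right, inner_neg_left, hnL, h]
  ring

lemma ip6_add_left (u v w : V6) : ip6 (u + v) w = ip6 u w + ip6 v w := by
  simp only [ip6, Prod.fst_add, Prod.snd_add, inner_add_left]
  ring

lemma ip6_sub_left (u v w : V6) : ip6 (u - v) w = ip6 u w - ip6 v w := by
  simp only [ip6, Prod.fst_sub, Prod.snd_sub, inner_sub_left]
  ring

lemma ip6_smul_left (r : ℝ) (v w : V6) : ip6 (r • v) w = r * ip6 v w := by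
  simp only [ip6, Prod.smul_fst, Prod.smul_snd, real_inner_smul_left]
  ring

lemma ip6_comm (v w : V6) : ip6 v w = ip6 w v := by
  simp only [ip6, real_inner_comm]

lemma eq_zero_of_ip6_self {v : V6} (h : ip6 v v = 0) : v = 0 := by
  have h1 : 0 ≤ ⟪v.1, v.1⟫_ℝ := real_inner_self_nonneg
  have h2 : 0 ≤ ⟪v.2, v.2⟫_ℝ := real_inner_self_nonneg
  have h' : ⟪v.1, v.1⟫_ℝ + ⟪v.2, v.2⟫_ℝ = 0 := h
  exact Prod.ext ((inner_self_eq_zero (𝕜 := ℝ)).1 (by linarith))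
    ((inner_self_eq_zero (𝕜 := ℝ)).1 (by linarith))

/-- `ℝ⁶` is spanned by the tangent space and its image under `J`. -/
lemma exists_eq_bundleDiff_add_Jc (hL : Function.Injective L)
    (hn : ‖n‖ = 1) (hnL : ∀ v, ⟪n, L v⟫_ℝ = 0) (y : V6) :
    ∃ v w, y = bundleDiff L n a v + Jc (bundleDiff L n a w) := by
  obtain ⟨A, hA⟩ := exists_eq_add_smul_normal hL hn hnL y.1
  obtain ⟨B, hB⟩ := exists_eq_add_smul_normal hL hn hnL y.2
  have ha : 1 + a ^ 2 ≠ 0 := by positivity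
  refine ⟨((1 + a ^ 2)⁻¹ • (A + a • B), ⟪n, y.2⟫_ℝ),
    ((1 + a ^ 2)⁻¹ • (B - a • A), -⟪n, y.1⟫_ℝ), Prod.ext ?_ ?_⟩
  · refine hA.trans ?_
    simp only [bundleDiff, Jc, Prod.fst_add, map_smul, map_add, map_sub]
    match_scalars <;> field_simp
    ring
  · refine hB.trans ?_
    simp only [bundleDiff, Jc, Prod.snd_add, map_smul, map_add, map_sub]
    match_scalars <;> field_simp <;> ring

/-- The orthogonal complement of the tangent space is its image under `J`. -/
lemma exists_eq_Jc_bundleDiff (hL : Function.Injective L)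
    (hn : ‖n‖ = 1) (hnL : ∀ v, ⟪n, L v⟫_ℝ = 0) (y : V6)
    (hy : ∀ v, ip6 y (bundleDiff L n a v) = 0) :
    ∃ w, y = Jc (bundleDiff L n a w) := by
  obtain ⟨v, w, rfl⟩ := exists_eq_bundleDiff_add_Jc (a := a) hL hn hnL y
  have h := hy v
  rw [ip6_add_left, ip6_Jc_bundleDiff hnL, add_zero] at h
  exact ⟨w, by rw [eq_zero_of_ip6_self h, zero_add]⟩

/-- The vertical vector `(0, 1)` expanded in an orthonormal frame. -/
lemma vertical_eq_sum_of_orthonormal (hn : ‖n‖ = 1) (hnL : ∀ v, ⟪n, L v⟫_ℝ = 0)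
    (e : Fin 3 → W3)
    (he : ∀ i j, ip6 (bundleDiff L n a (e i)) (bundleDiff L n a (e j)) =
      if i = j then 1 else 0) :
    ((0, 1) : W3) = ∑ i, (e i).2 • e i := by
  have hsum : ∀ (g : Fin 3 → ℝ) (j : Fin 3),
      ip6 (bundleDiff L n a (∑ i, g i • e i)) (bundleDiff L n a (e j)) = g j := by
    intro g j
    have h : bundleDiff L n a (∑ i, g i • e i) = ∑ i, g i • bundleDiff L n a (e i) := by
      simp only [Fin.sum_univ_three, bundleDiff, Prod.fst_add, Prod.snd_add, Prod.smul_fst,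
        Prod.smul_snd, map_add, map_smul, smul_eq_mul]
      refine Prod.ext rfl ?_
      simp only [Prod.snd_add, Prod.smul_snd]
      module
    rw [h]
    simp only [Fin.sum_univ_three, ip6_add_left, ip6_smul_left, he]
    fin_cases j <;> simp
  have hli : LinearIndependent ℝ e := by
    rw [Fintype.linearIndependent_iff]
    intro g hg j
    rw [← hsum g j, hg]
    simp [bundleDiff, ip6]
  have hspan : (⊤ : Submodule ℝ W3) ≤ Submodule.span ℝ (Set.range e) :=
    (hli.span_eq_top_of_card_eq_finrank' (by simp)).ge
  obtain ⟨g, hg⟩ := (Submodule.mem_span_range_iff_exists_fun ℝ).1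
    (hspan (Submodule.mem_top (x := ((0, 1) : W3))))
  have hgj : ∀ j, g j = (e j).2 := by
    intro j
    rw [← hsum g j, hg, ip6_bundleDiff hn hnL]
    simp
  rw [← hg]
  exact Finset.sum_congr rfl fun i _ => by rw [hgj]

end AbstractFrame

section Calculus

variable {U : Set (ℝ × ℝ)} {x N : ℝ × ℝ → E3}

lemma SurfaceData.contDiffAt_x (hS : SurfaceData U x N) {p : ℝ × ℝ} (hp : p ∈ U) :
    ContDiffAt ℝ (⊤ : ℕ∞) x p :=
  hS.smooth_x.contDiffAt (hS.open_U.mem_nhds hp)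

lemma SurfaceData.differentiableAt_x (hS : SurfaceData U x N) {p : ℝ × ℝ} (hp : p ∈ U) :
    DifferentiableAt ℝ x p :=
  (hS.contDiffAt_x hp).differentiableAt (by simp)

lemma SurfaceData.differentiableAt_fderiv_x (hS : SurfaceData U x N) {p : ℝ × ℝ}
    (hp : p ∈ U) : DifferentiableAt ℝ (fderiv ℝ x) p := by
  have h : ContDiffAt ℝ 1 (fderiv ℝ x) p :=
    (hS.contDiffAt_x hp).fderiv_right (WithTop.coe_le_coe.2 le_top)
  exact h.differentiableAt (by simp)

/-- On a connected piece of a round sphere the unit normal is a constant multiple of the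
position vector. -/
lemma SurfaceData.exists_normal_eq_smul (hS : SurfaceData U x N) {c : E3} {ρ : ℝ} (hρ : 0 < ρ)
    (hsph : ∀ p ∈ U, ‖x p - c‖ = ρ) :
    ∃ k : ℝ, k ≠ 0 ∧ ∀ p ∈ U, N p = k • (x p - c) := by
  have hperp : ∀ p ∈ U, ∀ v, ⟪x p - c, fderiv ℝ x p v⟫_ℝ = 0 := by
    intro p hp v
    have hx : HasFDerivAt (fun y => x y - c) (fderiv ℝ x p) p :=
      (hS.differentiableAt_x hp).hasFDerivAt.sub_const c
    have h1 := hx.inner ℝ hx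
    have h2 : (fun y => ⟪x y - c, x y - c⟫_ℝ) =ᶠ[nhds p] fun _ => ρ ^ 2 := by
      filter_upwards [hS.open_U.mem_nhds hp] with y hy
      rw [real_inner_self_eq_norm_sq, hsph y hy]
    have h3 := congrArg (fun T => T v)
      ((h1.congr_of_eventuallyEq h2.symm).unique (hasFDerivAt_const (ρ ^ 2) p))
    simp [fderivInnerCLM_apply, real_inner_comm (x p - c)] at h3
    simpa [real_inner_comm (x p - c)] using h3
  have hdec : ∀ p ∈ U, x p - c = ⟪N p, x p - c⟫_ℝ • N p := by
    intro p hp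
    obtain ⟨v, hv⟩ := exists_eq_add_smul_normal (hS.immersion p hp) (hS.unit_N p hp)
      (hS.normal_N p hp) (x p - c)
    have h := hperp p hp v
    rw [hv, inner_add_left, real_inner_smul_left, hS.normal_N p hp, mul_zero, add_zero] at h
    rw [inner_self_eq_zero.1 h, zero_add] at hv
    exact hv
  have hsq : ∀ p ∈ U, ⟪N p, x p - c⟫_ℝ ^ 2 = ρ ^ 2 := by
    intro p hp
    have h := congrArg norm (hdec p hp)
    rw [norm_smul, hS.unit_N p hp, mul_one, hsph p hp] at h
    rw [h, Real.norm_eq_abs, sq_abs]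
  have hcont : ContinuousOn (fun p => ⟪N p, x p - c⟫_ℝ) U :=
    hS.smooth_N.continuousOn.inner (hS.smooth_x.continuousOn.sub continuousOn_const)
  have key : ∀ r : ℝ, r ≠ 0 → (∀ p ∈ U, ⟪N p, x p - c⟫_ℝ = r) →
      ∃ k : ℝ, k ≠ 0 ∧ ∀ p ∈ U, N p = k • (x p - c) := by
    intro r hr h
    refine ⟨r⁻¹, inv_ne_zero hr, fun p hp => ?_⟩
    rw [hdec p hp, h p hp, smul_smul, inv_mul_cancel₀ hr, one_smul]
  rcases hS.conn_U.isPreconnected.eq_or_eq_neg_of_sq_eq hcont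
    (continuousOn_const (c := ρ)) (fun p hp => hsq p hp) (fun _ => hρ.ne') with h | h
  · exact key ρ hρ.ne' fun p hp => h hp
  · exact key (-ρ) (neg_ne_zero.2 hρ.ne') fun p hp => h hp

lemma SurfaceData.hasFDerivAt_normal (hS : SurfaceData U x N) {c : E3} {k : ℝ}
    (hN : ∀ p ∈ U, N p = k • (x p - c)) {p : ℝ × ℝ} (hp : p ∈ U) :
    HasFDerivAt N (k • fderiv ℝ x p) p :=
  (((hS.differentiableAt_x hp).hasFDerivAt.sub_const c).const_smul k).congr_of_eventuallyEq
    (by filter_upwards [hS.open_U.mem_nhds hp] with y hy using hN y hy)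

lemma SurfaceData.fderiv_nbi (hS : SurfaceData U x N) {c : E3} {k : ℝ}
    (hN : ∀ p ∈ U, N p = k • (x p - c)) {q : W3} (hq : q.1 ∈ U) :
    ⇑(fderiv ℝ (nbi x N) q) = bundleDiff (fderiv ℝ x q.1) (N q.1) (q.2 * k) := by
  have h1 : HasFDerivAt (fun y : W3 => x y.1) _ q :=
    (hS.differentiableAt_x hq).hasFDerivAt.comp q hasFDerivAt_fst
  have h2 : HasFDerivAt (fun y : W3 => N y.1) _ q :=
    (hS.hasFDerivAt_normal hN hq).comp q hasFDerivAt_fst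
  have h3 : HasFDerivAt (nbi x N) _ q := h1.prodMk (hasFDerivAt_snd.smul h2)
  rw [h3.fderiv]
  funext v
  simp [bundleDiff, smul_smul]

/-- The second derivative of the normal bundle immersion of a piece of a sphere. -/
lemma SurfaceData.exists_d2_nbi (hS : SurfaceData U x N) {c : E3} {k : ℝ}
    (hN : ∀ p ∈ U, N p = k • (x p - c)) {q : W3} (hq : q.1 ∈ U) (v w : W3) :
    ∃ D : E3, ⟪N q.1, D⟫_ℝ = -k * ⟪fderiv ℝ x q.1 v.1, fderiv ℝ x q.1 w.1⟫_ℝ ∧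
      d2 (nbi x N) q v w = (D, (q.2 * k) • D +
        (v.2 * k) • fderiv ℝ x q.1 w.1 + (w.2 * k) • fderiv ℝ x q.1 v.1) := by
  have hG : HasFDerivAt (fun y => fderiv ℝ x y w.1)
      ((fderiv ℝ (fderiv ℝ x) q.1).flip w.1) q.1 := by
    have h := (hS.differentiableAt_fderiv_x hq).hasFDerivAt.clm_apply
      (hasFDerivAt_const w.1 q.1)
    simpa using h
  have hNq := hS.hasFDerivAt_normal hN hq
  refine ⟨fderiv ℝ (fderiv ℝ x) q.1 v.1 w.1, ?_, ?_⟩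
  · have h1 := hNq.inner ℝ hG
    have h2 : (fun y => ⟪N y, fderiv ℝ x y w.1⟫_ℝ) =ᶠ[nhds q.1] fun _ => (0 : ℝ) := by
      filter_upwards [hS.open_U.mem_nhds hq] with y hy using hS.normal_N y hy w.1
    have h3 := congrArg (fun T => T v.1)
      ((h1.congr_of_eventuallyEq h2.symm).unique (hasFDerivAt_const (0 : ℝ) q.1))
    simp [fderivInnerCLM_apply, real_inner_smul_left] at h3
    linarith
  · have heq : (fun y => fderiv ℝ (nbi x N) y w) =ᶠ[nhds q] fun y : W3 =>
        (fderiv ℝ x y.1 w.1, (y.2 * k) • fderiv ℝ x y.1 w.1 + w.2 • N y.1) := by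
      have hU : ∀ᶠ y : W3 in nhds q, y.1 ∈ U :=
        continuousAt_fst.eventually (hS.open_U.mem_nhds hq)
      filter_upwards [hU] with y hy
      rw [hS.fderiv_nbi hN hy]
      rfl
    have hG' : HasFDerivAt (fun y : W3 => fderiv ℝ x y.1 w.1) _ q :=
      hG.comp q hasFDerivAt_fst
    have hN' : HasFDerivAt (fun y : W3 => N y.1) _ q := hNq.comp q hasFDerivAt_fst
    have hsnd : HasFDerivAt (fun y : W3 => y.2) (ContinuousLinearMap.snd ℝ (ℝ × ℝ) ℝ) q :=
      hasFDerivAt_snd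
    have ht := hsnd.mul_const k
    have h := hG'.prodMk ((ht.smul hG').add (hN'.const_smul w.2))
    have h' := h.congr_of_eventuallyEq heq
    rw [d2, h'.fderiv]
    refine Prod.ext (by simp) ?_
    simp
    module

end Calculus

/-- The cubic form `⟨h(v, w), J df z⟩` of the normal bundle immersion of a piece of a sphere. -/
lemma SurfaceData.ip6_sff_nbi {U : Set (ℝ × ℝ)} {x N : ℝ × ℝ → E3} (hS : SurfaceData U x N)
    {c : E3} {k : ℝ} (hN : ∀ p ∈ U, N p = k • (x p - c)) {q : W3} (hq : q.1 ∈ U)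
    {v w : W3} {m : V6} (hm : IsSFF (nbi x N) q v w m) (z : W3) :
    ip6 m (Jc (fderiv ℝ (nbi x N) q z)) =
      k * (z.2 * ⟪fderiv ℝ x q.1 v.1, fderiv ℝ x q.1 w.1⟫_ℝ +
        v.2 * ⟪fderiv ℝ x q.1 w.1, fderiv ℝ x q.1 z.1⟫_ℝ +
        w.2 * ⟪fderiv ℝ x q.1 v.1, fderiv ℝ x q.1 z.1⟫_ℝ) := by
  obtain ⟨-, u, hu⟩ := hm
  obtain ⟨D, hD, hd2⟩ := hS.exists_d2_nbi hN hq v w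
  have h0 := ip6_Jc_bundleDiff (a := q.2 * k) (hS.normal_N q.1 hq) z u
  rw [← hS.fderiv_nbi hN hq, hu, ip6_comm, ip6_sub_left, sub_eq_zero] at h0
  rw [← h0, hd2, hS.fderiv_nbi hN hq]
  have hD' : ⟪D, N q.1⟫_ℝ = _ := (real_inner_comm _ _).trans hD
  simp only [ip6, bundleDiff, Jc, inner_add_left, inner_add_right, real_inner_smul_left,
    real_inner_smul_right, inner_neg_right, hD']
  ring

/-- If `x(U)` is contained in a round sphere, then the normal bundle
immersion is a Maslovian Lagrangian immersion into ℂ³. -/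
theorem sphere_normal_bundle_maslovian (U : Set (ℝ × ℝ)) (x N : ℝ × ℝ → E3)
    (hS : SurfaceData U x N) (c : E3) (ρ : ℝ) (hρ : 0 < ρ)
    (hsph : ∀ p ∈ U, ‖x p - c‖ = ρ) :
    ∀ q : W3, q.1 ∈ U → LagrangianAt (nbi x N) q ∧
      ∀ Hq : V6, IsMeanCurvAt (nbi x N) q Hq → MaslovianAt (nbi x N) q Hq := by
  intro q hq
  obtain ⟨k, hk, hN⟩ := hS.exists_normal_eq_smul hρ hsph
  have hL := hS.immersion q.1 hq
  have hn := hS.unit_N q.1 hq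
  have hnL := hS.normal_N q.1 hq
  have hdf := hS.fderiv_nbi hN hq
  have hsff := fun {v w m} => hS.ip6_sff_nbi hN hq (v := v) (w := w) (m := m)
  have hn0 : N q.1 ≠ 0 := by
    intro h
    simp [h] at hn
  set L := fderiv ℝ x q.1
  set n := N q.1
  set a := q.2 * k
  have ha : 1 + a ^ 2 ≠ 0 := by positivity
  refine ⟨⟨?_, ?_⟩, ?_⟩
  · rw [hdf]
    exact bundleDiff_injective hL hn
  · rw [hdf]
    ext y
    constructor
    · rintro ⟨_, ⟨v, rfl⟩, rfl⟩ _ ⟨w, rfl⟩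
      exact ip6_Jc_bundleDiff hnL v w
    · intro hy
      obtain ⟨w, rfl⟩ := exists_eq_Jc_bundleDiff (a := a) hL hn hnL y fun v => hy _ ⟨v, rfl⟩
      exact ⟨_, ⟨w, rfl⟩, rfl⟩
  · rintro _ ⟨v₁, v₂, v₃, ⟨h11, h22, h33, h12, h13, h23⟩, n₁, n₂, n₃, hn₁, hn₂, hn₃, rfl⟩
    set lam := 2 * k / (1 + a ^ 2) with hlam
    have hlam0 : lam ≠ 0 := div_ne_zero (mul_ne_zero two_ne_zero hk) ha
    have hH : n₁ + n₂ + n₃ = Jc (bundleDiff L n a (0, lam)) := by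
      rw [hdf] at h11 h22 h33 h12 h13 h23
      have hvert := vertical_eq_sum_of_orthonormal hn hnL ![v₁, v₂, v₃] (a := a) (by
        intro i j
        fin_cases i <;> fin_cases j <;> simp [*, ip6_comm])
      simp only [Fin.sum_univ_three, Matrix.cons_val] at hvert
      have hs : v₁.2 * v₁.2 + v₂.2 * v₂.2 + v₃.2 * v₃.2 = 1 := (congrArg Prod.snd hvert).symm
      have hX : v₁.2 • L v₁.1 + v₂.2 • L v₂.1 + v₃.2 • L v₃.1 = 0 := by
        have h : (0 : ℝ × ℝ) = v₁.2 • v₁.1 + v₂.2 • v₂.1 + v₃.2 • v₃.1 :=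
          congrArg Prod.fst hvert
        simpa using (congrArg L h).symm
      rw [ip6_bundleDiff hn hnL] at h11 h22 h33
      have htr : ⟪L v₁.1, L v₁.1⟫_ℝ + ⟪L v₂.1, L v₂.1⟫_ℝ + ⟪L v₃.1, L v₃.1⟫_ℝ =
          2 / (1 + a ^ 2) := by
        rw [eq_div_iff ha]
        linarith
      obtain ⟨w, hw⟩ := exists_eq_Jc_bundleDiff (a := a) hL hn hnL (n₁ + n₂ + n₃) (by
        intro v
        have e₁ := hn₁.1 v
        have e₂ := hn₂.1 v
        have e₃ := hn₃.1 v
        rw [hdf] at e₁ e₂ e₃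
        rw [ip6_add_left, ip6_add_left, e₁, e₂, e₃]
        ring)
      have hpair : ∀ z : W3,
          ip6 (bundleDiff L n a w) (bundleDiff L n a z) = lam * z.2 := by
        intro z
        have e₁ := hsff hn₁ z
        have e₂ := hsff hn₂ z
        have e₃ := hsff hn₃ z
        have hXz := congrArg (fun y => ⟪y, L z.1⟫_ℝ) hX
        simp only [inner_add_left, real_inner_smul_left, inner_zero_left] at hXz
        have hJ : ip6 (bundleDiff L n a w) (bundleDiff L n a z) =
            ip6 (n₁ + n₂ + n₃) (Jc (bundleDiff L n a z)) := by
          rw [hw]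
          simp only [ip6, Jc, inner_neg_neg]
          ring
        rw [hdf] at e₁ e₂ e₃
        rw [hJ, ip6_add_left, ip6_add_left, e₁, e₂, e₃, hlam]
        linear_combination (k * z.2) * htr + 2 * k * hXz
      have hzero : bundleDiff L n a w - bundleDiff L n a (0, lam) = 0 := by
        have hsub : bundleDiff L n a w - bundleDiff L n a (0, lam) =
            bundleDiff L n a (w - (0, lam)) := by
          simp [bundleDiff, sub_smul, add_sub_assoc]
        apply eq_zero_of_ip6_self
        nth_rewrite 2 [hsub]
        rw [ip6_sub_left, hpair, ip6_bundleDiff hn hnL]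
        simp
      rw [hw, sub_eq_zero.1 hzero]
    rw [hH]
    refine ⟨?_, ?_⟩
    · intro h
      have h1 : -(a • L 0 + lam • n) = 0 := congrArg Prod.fst h
      simp [hlam0, hn0] at h1
    · intro V u hV hu
      have hV' : V = (0, -lam) := by
        apply bundleDiff_injective (a := a) hL hn
        refine (congrFun hdf V).symm.trans (hV.trans ?_)
        simp [bundleDiff, Jc]
      refine ⟨0, ?_⟩
      rw [zero_smul]
      apply bundleDiff_injective (a := a) hL hn
      have hz : bundleDiff L n a 0 = 0 := by simp [bundleDiff]
      rw [hz]
      apply eq_zero_of_ip6_self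
      obtain ⟨r, s, hrs⟩ := exists_eq_bundleDiff_add_Jc (a := a) hL hn hnL
        (d2 (nbi x N) q V u)
      have hm : IsSFF (nbi x N) q V u (Jc (bundleDiff L n a s)) := by
        refine ⟨fun v => ?_, r, ?_⟩
        · rw [hdf]
          exact ip6_Jc_bundleDiff hnL s v
        · rw [hrs, hdf]
          abel
      have h1 := hu u _ hm
      have h2 := hsff hm (0, lam)
      rw [hdf] at h1 h2
      rw [h1, h2, hV']
      simp
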